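/- arXiv:1503.06501 — 2 statements merged into one kernel-verified Lean document; each statement's English description precedes it below -/
import Mathlib

section
/- Let X, Y, Z be a basis of ℝ³. Let ξ: ℝ → ℝ³ and ψ: ℝ² → ℝ³ be continuous functions. Suppose there exists K > 0 such that ‖rX − ξ(r)‖ < K for every r ∈ ℝ, and ‖sY + tZ − ψ(s,t)‖ < K for every (s,t) ∈ ℝ². Then there exist r, s, t ∈ ℝ such that ξ(r) = ψ(s,t). -/
open Finset in
/-- A discrete Stokes formula: the sum over an `N × N` square grid of the cup product of the
coboundaries of `b` and `c` equals `1` if `b` and `c` go from `0` to `1` between opposite sides. -/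
theorem sum_cup_square (N : ℕ) (b c : ℕ → ℕ → ℤ)
    (hb0 : ∀ k, b 0 k = 0) (hb1 : ∀ k, b N k = 1)
    (hc0 : ∀ j, c j 0 = 0) (hc1 : ∀ j, c j N = 1) :
    ∑ j ∈ range N, ∑ k ∈ range N,
      ((b (j + 1) k - b j k) * (c (j + 1) (k + 1) - c (j + 1) k)
        - (b j (k + 1) - b j k) * (c (j + 1) (k + 1) - c j (k + 1))) = 1 := by
  have stokes : ∀ j k, (b (j + 1) k - b j k) * (c (j + 1) (k + 1) - c (j + 1) k)
        - (b j (k + 1) - b j k) * (c (j + 1) (k + 1) - c j (k + 1))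
      = (b (j + 1) k * (c (j + 1) (k + 1) - c (j + 1) k) - b j k * (c j (k + 1) - c j k))
        - (b j (k + 1) * (c (j + 1) (k + 1) - c j (k + 1)) - b j k * (c (j + 1) k - c j k)) := by
    intro j k; ring
  simp_rw [stokes, sum_sub_distrib (s := range N)]
  rw [← sum_sub_distrib, sum_range_sub (fun j => ∑ k ∈ range N, b j k * (c j (k + 1) - c j k)),
    ← sum_sub_distrib]
  simp_rw [← sum_sub_distrib (s := range N)]
  have side : ∀ j, ∑ k ∈ range N,
      (b j (k + 1) * (c (j + 1) (k + 1) - c j (k + 1)) - b j k * (c (j + 1) k - c j k)) = 0 := by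
    intro j
    rw [sum_range_sub (fun k => b j k * (c (j + 1) k - c j k))]
    simp [hc0, hc1]
  simp [side, hb0, hb1, sum_range_sub (fun k => c N k), hc0, hc1]

open Finset in
/-- A cubical Sperner lemma: if each of three labellings of a cubical grid goes from `0` to `1`
between the corresponding opposite faces, then none of them is constant on some common cell. -/
theorem exists_cell_nonconstant (N : ℕ) (a b c : ℕ → ℕ → ℕ → ℤ)
    (ha0 : ∀ j k, a 0 j k = 0) (ha1 : ∀ j k, a N j k = 1)
    (hb0 : ∀ i k, b i 0 k = 0) (hb1 : ∀ i k, b i N k = 1)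
    (hc0 : ∀ i j, c i j 0 = 0) (hc1 : ∀ i j, c i j N = 1) :
    ∃ i < N, ∃ j < N, ∃ k < N, ∀ u ∈ ({a, b, c} : Set (ℕ → ℕ → ℕ → ℤ)),
      ∃ p ≤ 1, ∃ q ≤ 1, ∃ r ≤ 1, u (i + p) (j + q) (k + r) ≠ u i j k := by
  by_contra! hcon
  let β₂₃ : ℕ → ℕ → ℕ → ℤ := fun i j k =>
    (b i (j + 1) k - b i j k) * (c i (j + 1) (k + 1) - c i (j + 1) k)
      - (b i j (k + 1) - b i j k) * (c i (j + 1) (k + 1) - c i j (k + 1))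
  let β₁₃ : ℕ → ℕ → ℕ → ℤ := fun i j k =>
    (b (i + 1) j k - b i j k) * (c (i + 1) j (k + 1) - c (i + 1) j k)
      - (b i j (k + 1) - b i j k) * (c (i + 1) j (k + 1) - c i j (k + 1))
  let β₁₂ : ℕ → ℕ → ℕ → ℤ := fun i j k =>
    (b (i + 1) j k - b i j k) * (c (i + 1) (j + 1) k - c (i + 1) j k)
      - (b i (j + 1) k - b i j k) * (c (i + 1) (j + 1) k - c i (j + 1) k)
  have stokes : ∀ i j k,
      (a (i + 1) j k * β₂₃ (i + 1) j k - a i j k * β₂₃ i j k)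
        - (a i (j + 1) k * β₁₃ i (j + 1) k - a i j k * β₁₃ i j k)
        + (a i j (k + 1) * β₁₂ i j (k + 1) - a i j k * β₁₂ i j k)
      = (a (i + 1) j k - a i j k) * β₂₃ (i + 1) j k
        - (a i (j + 1) k - a i j k) * β₁₃ i (j + 1) k
        + (a i j (k + 1) - a i j k) * β₁₂ i j (k + 1) := by
    intro i j k; simp only [β₂₃, β₁₃, β₁₂]; ring
  have cell : ∀ i ∈ range N, ∀ j ∈ range N, ∀ k ∈ range N,
      (a (i + 1) j k * β₂₃ (i + 1) j k - a i j k * β₂₃ i j k)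
        - (a i (j + 1) k * β₁₃ i (j + 1) k - a i j k * β₁₃ i j k)
        + (a i j (k + 1) * β₁₂ i j (k + 1) - a i j k * β₁₂ i j k) = 0 := by
    intro i hi j hj k hk
    rw [stokes]
    obtain ⟨u, hu, hconst⟩ := hcon i (mem_range.1 hi) j (mem_range.1 hj) k (mem_range.1 hk)
    have h100 := hconst 1 le_rfl 0 zero_le_one 0 zero_le_one
    have h010 := hconst 0 zero_le_one 1 le_rfl 0 zero_le_one
    have h001 := hconst 0 zero_le_one 0 zero_le_one 1 le_rfl
    have h110 := hconst 1 le_rfl 1 le_rfl 0 zero_le_one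
    have h101 := hconst 1 le_rfl 0 zero_le_one 1 le_rfl
    have h011 := hconst 0 zero_le_one 1 le_rfl 1 le_rfl
    have h111 := hconst 1 le_rfl 1 le_rfl 1 le_rfl
    simp only [add_zero] at h100 h010 h001 h110 h101 h011
    rcases hu with rfl | rfl | rfl <;> simp only [β₂₃, β₁₃, β₁₂, h100, h010, h001, h110, h101,
      h011, h111] <;> ring
  have total := sum_eq_zero fun i hi => sum_eq_zero fun j hj => sum_eq_zero (cell i hi j hj)
  have face₁ : ∑ i ∈ range N, ∑ j ∈ range N, ∑ k ∈ range N,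
      (a (i + 1) j k * β₂₃ (i + 1) j k - a i j k * β₂₃ i j k) = 1 := by
    simp_rw [sum_sub_distrib (s := range N)]
    rw [← sum_sub_distrib, sum_range_sub (fun i => ∑ j ∈ range N, ∑ k ∈ range N,
      a i j k * β₂₃ i j k)]
    simp only [ha0, ha1, one_mul, zero_mul, sum_const_zero, sub_zero]
    exact sum_cup_square N (b N) (c N) (hb0 N) (hb1 N) (hc0 N) (hc1 N)
  have face₂ : ∀ i, ∑ j ∈ range N, ∑ k ∈ range N,
      (a i (j + 1) k * β₁₃ i (j + 1) k - a i j k * β₁₃ i j k) = 0 := by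
    intro i
    rw [sum_comm]
    refine sum_eq_zero fun k _ => ?_
    rw [sum_range_sub (fun j => a i j k * β₁₃ i j k)]
    simp [β₁₃, hb0, hb1]
  have face₃ : ∀ i j, ∑ k ∈ range N,
      (a i j (k + 1) * β₁₂ i j (k + 1) - a i j k * β₁₂ i j k) = 0 := by
    intro i j
    rw [sum_range_sub (fun k => a i j k * β₁₂ i j k)]
    simp [β₁₂, hc0, hc1]
  have sum_face₂ := sum_eq_zero fun i (_ : i ∈ range N) => face₂ i
  have sum_face₃ := sum_eq_zero fun i (_ : i ∈ range N) =>
    sum_eq_zero fun j (_ : j ∈ range N) => face₃ i j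
  simp only [sum_add_distrib, sum_sub_distrib] at total face₁ sum_face₂ sum_face₃
  linarith

/-- A continuous self-map of `ℝ³`, given by its coordinates, at bounded distance from the identity
has a zero. -/
theorem exists_zero_of_bounded_sub_id (f : Fin 3 → (Fin 3 → ℝ) → ℝ) (hf : ∀ i, Continuous (f i))
    (C : ℝ) (hC : ∀ i x, |f i x - x i| ≤ C) : ∃ x, ∀ i, f i x = 0 := by
  by_contra! hne
  have hC0 : 0 ≤ C := (abs_nonneg _).trans (hC 0 0)
  obtain ⟨M, hM⟩ : ∃ M, M = C + 1 := ⟨_, rfl⟩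
  let F : (Fin 3 → ℝ) → Fin 3 → ℝ := fun x i => f i x
  have hF : Continuous F := continuous_pi hf
  let B : Set (Fin 3 → ℝ) := Set.Icc (fun _ => -M) (fun _ => M)
  have hB : IsCompact B := isCompact_Icc
  have hB0 : B.Nonempty := Set.nonempty_Icc.2 fun _ => by linarith
  obtain ⟨x₀, -, hmin⟩ := hB.exists_isMinOn hB0 hF.norm.continuousOn
  have hε : 0 < ‖F x₀‖ := by
    obtain ⟨i, hi⟩ := hne x₀
    exact norm_pos_iff.2 fun h => hi (congrFun h i)
  obtain ⟨δ, hδ, huc⟩ := Metric.uniformContinuousOn_iff.1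
    (hB.uniformContinuousOn_of_continuous hF.continuousOn) _ hε
  obtain ⟨n, hn⟩ := exists_nat_gt (2 * M / δ)
  obtain ⟨N, hN⟩ : ∃ N, N = n + 1 := ⟨_, rfl⟩
  have hNpos : (0 : ℝ) < N := by rw [hN]; positivity
  have hmesh : 2 * M / N < δ := by
    rw [div_lt_iff₀ hδ] at hn
    rw [div_lt_iff₀ hNpos, hN]
    push_cast
    nlinarith
  let g : ℕ → ℝ := fun i => -M + i * (2 * M / N)
  have hg0 : g 0 = -M := by simp [g]
  have hgN : g N = M := by simp only [g]; field_simp; ring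
  have hgmem : ∀ i ≤ N, -M ≤ g i ∧ g i ≤ M := by
    intro i hi
    have hi' : (i : ℝ) ≤ N := by exact_mod_cast hi
    have hstep : 0 ≤ 2 * M / N := by rw [hM]; positivity
    constructor
    · have : 0 ≤ i * (2 * M / N) := by positivity
      simp only [g]; linarith
    · rw [← hgN]; simp only [g]; gcongr
  have hgstep : ∀ i, ∀ p ≤ 1, |g (i + p) - g i| < δ := by
    intro i p hp
    have hstep : 0 ≤ 2 * M / N := by rw [hM]; positivity
    have : g (i + p) - g i = p * (2 * M / N) := by simp only [g]; push_cast; ring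
    rw [this, abs_of_nonneg (by positivity)]
    have hp' : (p : ℝ) ≤ 1 := by exact_mod_cast hp
    nlinarith
  let v : ℕ → ℕ → ℕ → Fin 3 → ℝ := fun i j k => ![g i, g j, g k]
  have hvmem : ∀ i ≤ N, ∀ j ≤ N, ∀ k ≤ N, v i j k ∈ B := by
    intro i hi j hj k hk
    constructor <;> intro l <;> fin_cases l <;> simp [v, hgmem, hi, hj, hk]
  let label : Fin 3 → ℕ → ℕ → ℕ → ℤ := fun l i j k => if 0 < f l (v i j k) then 1 else 0
  have hlow : ∀ l i j k, v i j k l = -M → label l i j k = 0 := by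
    intro l i j k h
    have := (abs_le.1 (hC l (v i j k))).2
    exact if_neg (by linarith)
  have hhigh : ∀ l i j k, v i j k l = M → label l i j k = 1 := by
    intro l i j k h
    have := (abs_le.1 (hC l (v i j k))).1
    exact if_pos (by linarith)
  obtain ⟨i, hi, j, hj, k, hk, hcell⟩ := exists_cell_nonconstant N (label 0) (label 1) (label 2)
    (fun j k => hlow _ _ _ _ hg0) (fun j k => hhigh _ _ _ _ hgN)
    (fun i k => hlow _ _ _ _ hg0) (fun i k => hhigh _ _ _ _ hgN)
    (fun i j => hlow _ _ _ _ hg0) (fun i j => hhigh _ _ _ _ hgN)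
  have hbase := hvmem i hi.le j hj.le k hk.le
  have hsmall : ‖F (v i j k)‖ < ‖F x₀‖ := by
    rw [pi_norm_lt_iff hε]
    intro l
    obtain ⟨p, hp, q, hq, r, hr, hlab⟩ := hcell (label l) (by fin_cases l <;> simp)
    have hdist : dist (v (i + p) (j + q) (k + r)) (v i j k) < δ := by
      rw [dist_pi_lt_iff hδ]
      intro l
      fin_cases l <;> simp [v, Real.dist_eq, hgstep, hp, hq, hr]
    have hclose := huc _ (hvmem _ (by omega) _ (by omega) _ (by omega)) _ hbase hdist
    have hl := abs_lt.1 ((dist_le_pi_dist _ _ l).trans_lt hclose)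
    simp only [F] at hl
    simp only [label] at hlab
    rw [Real.norm_eq_abs, abs_lt]
    simp only [F]
    split_ifs at hlab <;> first | exact absurd rfl hlab | constructor <;> linarith
  exact absurd (hmin hbase) (not_le.2 hsmall)

/-- **Lemma (intersection property).**
Let `X, Y, Z` be a basis of `ℝ³` (with its Euclidean norm). Let `ξ : ℝ → ℝ³` and
`ψ : ℝ² → ℝ³` be continuous functions. Suppose there exists `K > 0` such that
`‖r • X - ξ r‖ < K` for every `r ∈ ℝ`, and `‖s • Y + t • Z - ψ (s, t)‖ < K` for every
`(s, t) ∈ ℝ²`. Then there exist `r, s, t` such that `ξ r = ψ (s, t)`. -/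
theorem intersection_property
    (X Y Z : EuclideanSpace ℝ (Fin 3))
    (hindep : LinearIndependent ℝ ![X, Y, Z])
    (hspan : Submodule.span ℝ {X, Y, Z} = ⊤)
    (ξ : ℝ → EuclideanSpace ℝ (Fin 3))
    (ψ : ℝ × ℝ → EuclideanSpace ℝ (Fin 3))
    (hξ : Continuous ξ) (hψ : Continuous ψ)
    (K : ℝ) (hK : 0 < K)
    (hξK : ∀ r : ℝ, ‖r • X - ξ r‖ < K)
    (hψK : ∀ s t : ℝ, ‖s • Y + t • Z - ψ (s, t)‖ < K) :
    ∃ r s t : ℝ, ξ r = ψ (s, t) := by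
  let b : Module.Basis (Fin 3) ℝ (EuclideanSpace ℝ (Fin 3)) :=
    Module.Basis.mk hindep (by
      rw [← hspan]; apply Submodule.span_mono
      simp [Set.insert_subset_iff])
  have hb : ∀ w : Fin 3 → ℝ, b.equivFun (w 0 • X + w 1 • Y + w 2 • Z) = w := by
    intro w
    rw [← LinearEquiv.eq_symm_apply]
    simp [b, Module.Basis.equivFun_symm_apply, Fin.sum_univ_three]
  let e : EuclideanSpace ℝ (Fin 3) →L[ℝ] Fin 3 → ℝ := b.equivFunL
  obtain ⟨x, hx⟩ := exists_zero_of_bounded_sub_id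
    (fun l x => e (ξ (x 0) - ψ (-x 1, -x 2)) l) (fun l => by fun_prop) (‖e‖ * (2 * K)) (by
      intro l x
      have hxl : x l = e (x 0 • X + x 1 • Y + x 2 • Z) l := (congrFun (hb x) l).symm
      have hsub : e (ξ (x 0) - ψ (-x 1, -x 2)) l - x l
          = e (((-x 1) • Y + (-x 2) • Z - ψ (-x 1, -x 2)) - (x 0 • X - ξ (x 0))) l := by
        rw [hxl, ← Pi.sub_apply, ← map_sub]
        refine congrArg (fun v => e v l) ?_
        module
      rw [hsub, ← Real.norm_eq_abs]
      refine (norm_le_pi_norm _ l).trans ((e.le_opNorm _).trans ?_)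
      gcongr
      refine (norm_sub_le _ _).trans ?_
      linarith [hξK (x 0), hψK (-x 1) (-x 2)])
  refine ⟨x 0, -x 1, -x 2, sub_eq_zero.1 (b.equivFun.injective ?_)⟩
  rw [map_zero]
  exact funext hx
end

section
/- Let f: 𝕋³ → 𝕋³ be a homeomorphism of the 3-torus preserving Haar (Lebesgue) measure. If f is not topologically transitive, then there exist non-empty, disjoint, regular open sets U, V ⊂ 𝕋³ with f(U) = U and f(V) = V. -/
open MeasureTheory

theorem Homeomorph.isOpenMap_toEquiv_zpow {X : Type*} [TopologicalSpace X] (f : X ≃ₜ X) (n : ℤ) :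
    IsOpenMap (f.toEquiv ^ n : Equiv.Perm X) := by
  let φ : (X ≃ₜ X) →* Equiv.Perm X :=
    { toFun := Homeomorph.toEquiv, map_one' := rfl, map_mul' := fun _ _ => rfl }
  have h : (f ^ n).toEquiv = f.toEquiv ^ n := map_zpow φ f n
  rw [← h]
  exact (f ^ n).isOpenMap

theorem Equiv.Perm.image_iUnion_zpow_image {X : Type*} (e : Equiv.Perm X) (s : Set X) :
    e '' (⋃ n : ℤ, (e ^ n) '' s) = ⋃ n : ℤ, (e ^ n) '' s := by
  have h (n : ℤ) : e '' ((e ^ n) '' s) = (e ^ (n + 1)) '' s := by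
    rw [← Set.image_comp, ← Equiv.Perm.coe_mul, add_comm, zpow_one_add]
  simp_rw [Set.image_iUnion, h]
  exact (Equiv.addRight (1 : ℤ)).iSup_comp (g := fun n => ⇑(e ^ n) '' s)

theorem IsOpen.closure_interior_closure {X : Type*} [TopologicalSpace X] {s : Set X}
    (hs : IsOpen s) : closure (interior (closure s)) = closure s :=
  (closure_minimal interior_subset isClosed_closure).antisymm
    (closure_mono (interior_maximal subset_closure hs))

/-- **Lemma (complementary pair of invariant regular open sets).**
Let `f : 𝕋³ → 𝕋³` be a homeomorphism of the 3-torus preserving Haar (Lebesgue) measure.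
If `f` is not topologically transitive (i.e. it is not the case that for all nonempty open
`U₀, V₀` there is `n : ℤ` with `fⁿ(U₀) ∩ V₀ ≠ ∅`), then there exist non-empty, disjoint,
regular open sets `U, V ⊆ 𝕋³` with `f(U) = U` and `f(V) = V`. -/
theorem invariant_regular_open_pair_of_not_transitive
    (f : (Fin 3 → AddCircle (1 : ℝ)) ≃ₜ (Fin 3 → AddCircle (1 : ℝ)))
    (hvol : MeasurePreserving f volume volume)
    (hNT : ¬ ∀ U₀ V₀ : Set (Fin 3 → AddCircle (1 : ℝ)),
        IsOpen U₀ → U₀.Nonempty → IsOpen V₀ → V₀.Nonempty →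
        ∃ n : ℤ, ((f.toEquiv ^ n) '' U₀ ∩ V₀).Nonempty) :
    ∃ U V : Set (Fin 3 → AddCircle (1 : ℝ)),
      IsOpen U ∧ IsOpen V ∧ U.Nonempty ∧ V.Nonempty ∧ U ∩ V = ∅ ∧
      U = interior (closure U) ∧ V = interior (closure V) ∧
      f '' U = U ∧ f '' V = V := by
  push Not at hNT
  obtain ⟨U₀, V₀, hU₀, hU₀ne, hV₀, hV₀ne, hdisj⟩ := hNT
  set W := ⋃ n : ℤ, (f.toEquiv ^ n) '' U₀
  have hW : IsOpen W := isOpen_iUnion fun n => f.isOpenMap_toEquiv_zpow n _ hU₀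
  have hfW : f '' W = W := Equiv.Perm.image_iUnion_zpow_image f.toEquiv U₀
  have hfcl : f '' closure W = closure W := by rw [f.image_closure, hfW]
  have hUW : U₀ ⊆ W := fun x hx => Set.mem_iUnion.2 ⟨0, x, hx, rfl⟩
  have hWV : Disjoint W V₀ :=
    Set.disjoint_iUnion_left.2 fun n => Set.disjoint_iff_inter_eq_empty.2 (hdisj n)
  refine ⟨interior (closure W), (closure W)ᶜ, isOpen_interior, isClosed_closure.isOpen_compl,
    (hU₀ne.mono hUW).mono (interior_maximal subset_closure hW),
    hV₀ne.mono (hWV.closure_left hV₀).subset_compl_left, ?_, ?_, ?_, ?_, ?_⟩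
  · exact Set.disjoint_iff_inter_eq_empty.1
      (Set.disjoint_compl_right_iff_subset.2 interior_subset)
  · rw [hW.closure_interior_closure]
  · rw [closure_compl, interior_compl, hW.closure_interior_closure]
  · rw [f.image_interior, hfcl]
  · rw [Set.image_compl_eq f.bijective, hfcl]
end
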